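/- arXiv:1803.03349 — 7 statements merged into one kernel-verified Lean document; each statement's English description precedes it below -/
import Mathlib

section
/- For every fixed t_0 > 0, the function h ↦ ρ(h, t_0) is strictly decreasing on the interval [0, ∞). -/
noncomputable def phi0 (t : ℝ) : ℝ := 4*t^2+4*t^3+5*t^4+2*t^5+t^6
noncomputable def phi1 (t : ℝ) : ℝ := -2-7*t-4*t^2+t^3-2*t^4-8*t^5-12*t^6-9*t^7-4*t^8-t^9
noncomputable def phi2 (t : ℝ) : ℝ := -8-37*t-76*t^2-101*t^3-109*t^4-102*t^5-77*t^6-43*t^7-16*t^8-3*t^9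
noncomputable def phi3 (t : ℝ) : ℝ := -12-69*t-180*t^2-288*t^3-322*t^4-268*t^5-168*t^6-76*t^7-22*t^8-3*t^9
noncomputable def phi4 (t : ℝ) : ℝ := -8-55*t-168*t^2-302*t^3-356*t^4-288*t^5-160*t^6-58*t^7-12*t^8-t^9
noncomputable def phi5 (t : ℝ) : ℝ := -2-16*t-56*t^2-112*t^3-140*t^4-112*t^5-56*t^6-16*t^7-2*t^8

noncomputable def rho (h t : ℝ) : ℝ :=
  phi0 t + phi1 t * h + phi2 t * h^2 + phi3 t * h^3 + phi4 t * h^4 + phi5 t * h^5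

theorem phi1_neg {t : ℝ} (ht : 0 < t) : phi1 t < 0 := by
  have hquad : 0 < 4 - t + 2*t^2 := by nlinarith [sq_nonneg (t - 1)]
  have hpos : 0 < 2+7*t+t^2*(4-t+2*t^2)+8*t^5+12*t^6+9*t^7+4*t^8+t^9 := by positivity
  unfold phi1
  linarith

theorem phi2_neg {t : ℝ} (ht : 0 < t) : phi2 t < 0 := by
  have hpos : 0 < 8+37*t+76*t^2+101*t^3+109*t^4+102*t^5+77*t^6+43*t^7+16*t^8+3*t^9 := by
    positivity
  unfold phi2
  linarith

theorem phi3_neg {t : ℝ} (ht : 0 < t) : phi3 t < 0 := by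
  have hpos : 0 < 12+69*t+180*t^2+288*t^3+322*t^4+268*t^5+168*t^6+76*t^7+22*t^8+3*t^9 := by
    positivity
  unfold phi3
  linarith

theorem phi4_neg {t : ℝ} (ht : 0 < t) : phi4 t < 0 := by
  have hpos : 0 < 8+55*t+168*t^2+302*t^3+356*t^4+288*t^5+160*t^6+58*t^7+12*t^8+t^9 := by
    positivity
  unfold phi4
  linarith

theorem phi5_neg {t : ℝ} (ht : 0 < t) : phi5 t < 0 := by
  have hpos : 0 < 2+16*t+56*t^2+112*t^3+140*t^4+112*t^5+56*t^6+16*t^7+2*t^8 := by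
    positivity
  unfold phi5
  linarith

theorem rho_strictAntiOn (t0 : ℝ) (ht0 : 0 < t0) :
    StrictAntiOn (fun h : ℝ => rho h t0) (Set.Ici 0) := by
  intro a ha b _ hab
  have ha : 0 ≤ a := ha
  have hpow {n : ℕ} (hn : n ≠ 0) : a^n < b^n := pow_lt_pow_left₀ hab ha hn
  have h1 := mul_lt_mul_of_neg_left hab (phi1_neg ht0)
  have h2 := mul_lt_mul_of_neg_left (hpow two_ne_zero) (phi2_neg ht0)
  have h3 := mul_lt_mul_of_neg_left (hpow three_ne_zero) (phi3_neg ht0)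
  have h4 := mul_lt_mul_of_neg_left (hpow four_ne_zero) (phi4_neg ht0)
  have h5 := mul_lt_mul_of_neg_left (hpow (OfNat.ofNat_ne_zero 5)) (phi5_neg ht0)
  simp only [rho]
  linarith
end

section
/- The set R = {(0,0)} ∪ {(h,k) ∈ ℝ × ℝ : h > 0, k > 0, p(h,k) ≥ 0} is star-shaped with respect to the point (0,0) (i.e., for every point of R the segment joining it to (0,0) lies in R), and R has nonempty interior. -/
noncomputable def xi0 (h : ℝ) : ℝ := 2*h^9*(h+1)^4
noncomputable def xi1 (h : ℝ) : ℝ := h^8*(16*h+7)*(h+1)^3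
noncomputable def xi2 (h : ℝ) : ℝ := 4*h^6*(3*h+14*h^2+14*h^3-1)*(h+1)^2
noncomputable def xi3 (h : ℝ) : ℝ := h^5*(h+1)*(3*h+98*h^2+190*h^3+112*h^4-4)
noncomputable def xi4 (h : ℝ) : ℝ := h^4*(2*h+109*h^2+322*h^3+356*h^4+140*h^5-5)
noncomputable def xi5 (h : ℝ) : ℝ := 2*h^3*(h+1)*(5*h+46*h^2+88*h^3+56*h^4-1)
noncomputable def xi6 (h : ℝ) : ℝ := h^2*(h+1)*(13*h+64*h^2+104*h^3+56*h^4-1)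
noncomputable def xi7 (h : ℝ) : ℝ := h^2*(h+1)*(34*h+42*h^2+16*h^3+9)
noncomputable def xi8 (h : ℝ) : ℝ := 2*h*(4*h+h^2+2)*(h+1)^2
noncomputable def xi9 (h : ℝ) : ℝ := (h+1)^3

noncomputable def p (h k : ℝ) : ℝ :=
  -(xi0 h + xi1 h * k + xi2 h * k^2 + xi3 h * k^3 + xi4 h * k^4
    + xi5 h * k^5 + xi6 h * k^6 + xi7 h * k^7 + xi8 h * k^8 + xi9 h * k^9)

noncomputable def R : Set (ℝ × ℝ) :=
  {((0 : ℝ), (0 : ℝ))} ∪ {q : ℝ × ℝ | 0 < q.1 ∧ 0 < q.2 ∧ 0 ≤ p q.1 q.2}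

/-- Along a ray through the origin into the open first quadrant, `p` is `t ^ 8` times a polynomial
in `t` all of whose nonconstant coefficients are nonpositive. -/
theorem p_along_ray {h k : ℝ} (hh : 0 < h) (hk : 0 < k) :
    ∃ a b₁ b₂ b₃ b₄ b₅ : ℝ, 0 ≤ b₁ ∧ 0 ≤ b₂ ∧ 0 ≤ b₃ ∧ 0 ≤ b₄ ∧ 0 ≤ b₅ ∧
      ∀ t : ℝ, p (t * h) (t * k) =
        t ^ 8 * (a - (t * b₁ + t ^ 2 * b₂ + t ^ 3 * b₃ + t ^ 4 * b₄ + t ^ 5 * b₅)) := by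
  have hq : 0 ≤ 4*h^2 - h*k + 2*k^2 := by nlinarith [sq_nonneg (h - k)]
  refine ⟨4*h^6*k^2 + 4*h^5*k^3 + 5*h^4*k^4 + 2*h^3*k^5 + h^2*k^6,
    2*h^9 + 7*h^8*k + h^5*k^2*(4*h^2 - h*k + 2*k^2) + 8*h^4*k^5 + 12*h^3*k^6
      + 9*h^2*k^7 + 4*h*k^8 + k^9,
    8*h^10 + 37*h^9*k + 76*h^8*k^2 + 101*h^7*k^3 + 109*h^6*k^4 + 102*h^5*k^5 + 77*h^4*k^6
      + 43*h^3*k^7 + 16*h^2*k^8 + 3*h*k^9,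
    12*h^11 + 69*h^10*k + 180*h^9*k^2 + 288*h^8*k^3 + 322*h^7*k^4 + 268*h^6*k^5 + 168*h^5*k^6
      + 76*h^4*k^7 + 22*h^3*k^8 + 3*h^2*k^9,
    8*h^12 + 55*h^11*k + 168*h^10*k^2 + 302*h^9*k^3 + 356*h^8*k^4 + 288*h^7*k^5 + 160*h^6*k^6
      + 58*h^5*k^7 + 12*h^4*k^8 + h^3*k^9,
    2*h^13 + 16*h^12*k + 56*h^11*k^2 + 112*h^10*k^3 + 140*h^9*k^4 + 112*h^8*k^5 + 56*h^7*k^6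
      + 16*h^6*k^7 + 2*h^5*k^8,
    by positivity, by positivity, by positivity, by positivity, by positivity, fun t ↦ ?_⟩
  simp only [p, xi0, xi1, xi2, xi3, xi4, xi5, xi6, xi7, xi8, xi9]
  ring

theorem p_smul_nonneg {h k t : ℝ} (hh : 0 < h) (hk : 0 < k) (ht₀ : 0 ≤ t) (ht₁ : t ≤ 1)
    (hp : 0 ≤ p h k) : 0 ≤ p (t * h) (t * k) := by
  obtain ⟨a, b₁, b₂, b₃, b₄, b₅, h₁, h₂, h₃, h₄, h₅, hray⟩ := p_along_ray hh hk
  have hone := hray 1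
  simp only [one_mul, one_pow] at hone
  rw [hray t]
  have e₁ := mul_le_of_le_one_left h₁ ht₁
  have e₂ := mul_le_of_le_one_left h₂ (pow_le_one₀ ht₀ ht₁ (n := 2))
  have e₃ := mul_le_of_le_one_left h₃ (pow_le_one₀ ht₀ ht₁ (n := 3))
  have e₄ := mul_le_of_le_one_left h₄ (pow_le_one₀ ht₀ ht₁ (n := 4))
  have e₅ := mul_le_of_le_one_left h₅ (pow_le_one₀ ht₀ ht₁ (n := 5))
  exact mul_nonneg (by positivity) (by linarith)

theorem continuous_p : Continuous fun q : ℝ × ℝ ↦ p q.1 q.2 := by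
  simp only [p, xi0, xi1, xi2, xi3, xi4, xi5, xi6, xi7, xi8, xi9]
  fun_prop

theorem R_starShaped_and_nonempty_interior :
    StarConvex ℝ ((0, 0) : ℝ × ℝ) R ∧ (interior R).Nonempty := by
  constructor
  · change StarConvex ℝ (0 : ℝ × ℝ) R
    rw [starConvex_zero_iff]
    rintro ⟨h, k⟩ hx t ht₀ ht₁
    rcases hx with hx | ⟨hh, hk, hp⟩
    · left
      obtain ⟨rfl, rfl⟩ := Prod.mk.inj (Set.mem_singleton_iff.mp hx)
      simp
    · rcases ht₀.eq_or_lt with rfl | ht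
      · left
        simp [Prod.ext_iff]
      · exact Or.inr ⟨mul_pos ht hh, mul_pos ht hk, p_smul_nonneg hh hk ht₀ ht₁ hp⟩
  · refine ⟨(1 / 100, 1 / 100), mem_interior.mpr
      ⟨{q : ℝ × ℝ | 0 < q.1 ∧ 0 < q.2 ∧ 0 < p q.1 q.2}, ?_, ?_, ?_⟩⟩
    · exact fun q hq ↦ Or.inr ⟨hq.1, hq.2.1, hq.2.2.le⟩
    · exact (isOpen_lt continuous_const continuous_fst).inter
        ((isOpen_lt continuous_const continuous_snd).inter
          (isOpen_lt continuous_const continuous_p))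
    · norm_num [p, xi0, xi1, xi2, xi3, xi4, xi5, xi6, xi7, xi8, xi9]
end

section
/- For every t > 0 one has ρ(14/100, t) < 0. -/
theorem rho_neg_at_fourteen_hundredths (t : ℝ) (ht : 0 < t) :
    rho (14/100) t < 0 := by
  unfold rho phi0 phi1 phi2 phi3 phi4 phi5
  rcases le_total t (7/10) with h | h
  · have h3 : t^3 ≤ 7/10 * t^2 := by nlinarith [mul_le_mul_of_nonneg_right h (sq_nonneg t)]
    have h4 : t^4 ≤ 7/10 * t^3 := by nlinarith [mul_le_mul_of_nonneg_right h (pow_pos ht 3).le]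
    have h2 : t^2 ≤ 7/10 * t := by nlinarith
    have p5 := pow_pos ht 5
    have p6 := pow_pos ht 6
    have p7 := pow_pos ht 7
    have p8 := pow_pos ht 8
    have p9 := pow_pos ht 9
    linarith
  · obtain ⟨u, hu, rfl⟩ : ∃ u : ℝ, 0 ≤ u ∧ t = u + 7/10 := ⟨t - 7/10, by linarith, by ring⟩
    rw [← neg_pos]
    ring_nf
    positivity
end

section
/- For every h ≥ 14/100 and every k > 0 one has p(h,k) < 0. (Consequently, with h_M = max{h : (h,k) lies in the semi-cubic hyponormality region}, one has 0 < h_M < 14/100.) -/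
/-- A univariate polynomial minorant of `-h * p h (h * t) / h ^ 9` is positive for `t > 0`. -/
lemma minorant_pos (t : ℝ) (ht : 0 < t) :
    0 < (191/100) * t - (139/100) * t^2 - (125/100) * t^3 - (156/100) * t^4
      + (197/100) * t^5 + (271/100) * t^6 + (233/100) * t^7 := by
  have key : 0 < (191/100) - (139/100) * t - (125/100) * t^2 - (156/100) * t^3
      + (197/100) * t^4 + (271/100) * t^5 + (233/100) * t^6 := by
    nlinarith [mul_nonneg ht.le (sq_nonneg (t^2 - 1/2)), sq_nonneg (t^2 - t/2 - 1/5),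
      sq_nonneg (t^3 - 1/3), sq_nonneg (t - 2/3), mul_nonneg ht.le (sq_nonneg (t - 2/3)),
      sq_nonneg (t * (t - 2/3)), mul_nonneg ht.le (sq_nonneg (t * (t - 2/3))),
      sq_nonneg (t^2 * (t - 2/3))]
  nlinarith [mul_pos ht key]

/-- Substituting `k = h * t` and clearing one denominator makes the coefficients polynomial. -/
lemma scaled_pos (h t : ℝ) (hh : 14/100 ≤ h) (ht : 0 < t) :
    0 < 2*h*(h+1)^4 + h*(16*h+7)*(h+1)^3 * t + 4*(3*h+14*h^2+14*h^3-1)*(h+1)^2 * t^2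
      + (h+1)*(3*h+98*h^2+190*h^3+112*h^4-4) * t^3
      + (2*h+109*h^2+322*h^3+356*h^4+140*h^5-5) * t^4
      + 2*(h+1)*(5*h+46*h^2+88*h^3+56*h^4-1) * t^5
      + (h+1)*(13*h+64*h^2+104*h^3+56*h^4-1) * t^6
      + h*(h+1)*(34*h+42*h^2+16*h^3+9) * t^7
      + 2*h*(4*h+h^2+2)*(h+1)^2 * t^8 + h*(h+1)^3 * t^9 := by
  have hmin := minorant_pos t ht
  obtain ⟨s, hs, rfl⟩ : ∃ s : ℝ, 0 ≤ s ∧ h = s + 14/100 := ⟨h - 14/100, by linarith, by ring⟩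
  refine hmin.trans_le (sub_nonneg.mp ?_)
  ring_nf
  positivity

theorem p_neg_of_h_ge (h k : ℝ) (hh : 14/100 ≤ h) (hk : 0 < k) : p h k < 0 := by
  have hpos : 0 < h := by linarith
  obtain ⟨t, ht, rfl⟩ : ∃ t : ℝ, 0 < t ∧ k = h * t :=
    ⟨k / h, div_pos hk hpos, by field_simp⟩
  have key := mul_pos (pow_pos hpos 8) (scaled_pos h t hh ht)
  refine neg_neg_of_pos (key.trans_eq ?_)
  simp only [xi0, xi1, xi2, xi3, xi4, xi5, xi6, xi7, xi8, xi9]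
  ring
end

section
/- For every fixed h > 0, the set {k > 0 : p(h,k) = 0} has at most two elements. -/
/-- Descartes' rule of signs for the sign pattern `+ - +`: a real polynomial function with positive
constant coefficient whose coefficients change sign at most twice does not have three positive
roots. -/
theorem not_three_pos_roots_of_sign_pattern {N m n : ℕ} (a : ℕ → ℝ) (hN : 0 < N) (hm : 0 < m)
    (hmn : m ≤ n) (h0 : 0 < a 0) (hlow : ∀ i < m, 0 ≤ a i) (hmid : ∀ i, m ≤ i → i < n → a i ≤ 0)
    (hhigh : ∀ i < N, n ≤ i → 0 ≤ a i) {x y z : ℝ} (hx : 0 < x) (hxy : x < y) (hyz : y < z)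
    (rx : ∑ i ∈ Finset.range N, a i * x ^ i = 0) (ry : ∑ i ∈ Finset.range N, a i * y ^ i = 0)
    (rz : ∑ i ∈ Finset.range N, a i * z ^ i = 0) : False := by
  set F : ℝ → ℝ := fun t => ∑ i ∈ Finset.range N, a i * t ^ ((i : ℤ) - m) with hF
  set G : ℝ → ℝ := fun t =>
    ∑ i ∈ Finset.range N, a i * (((i : ℤ) - m : ℤ) * t ^ ((i : ℤ) - m - 1)) with hG
  have hderiv : ∀ t, 0 < t → HasDerivAt F (G t) t := fun t ht =>
    HasDerivAt.fun_sum fun i _ => (hasDerivAt_zpow _ t (Or.inl ht.ne')).const_mul _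
  have hroot : ∀ t, 0 < t → ∑ i ∈ Finset.range N, a i * t ^ i = 0 → F t = 0 := by
    intro t ht h
    have : F t = (∑ i ∈ Finset.range N, a i * t ^ i) * (t ^ m)⁻¹ := by
      rw [hF, Finset.sum_mul]
      refine Finset.sum_congr rfl fun i _ => ?_
      rw [zpow_sub₀ ht.ne', zpow_natCast, zpow_natCast]
      ring
    rw [this, h, zero_mul]
  have hrolle : ∀ s t, 0 < s → s < t → F s = 0 → F t = 0 → ∃ c ∈ Set.Ioo s t, G c = 0 := by
    intro s t hs hst h1 h2
    refine exists_hasDerivAt_eq_zero hst (fun u hu => ?_) (h1.trans h2.symm) fun u hu => ?_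
    · exact (hderiv u (hs.trans_le hu.1)).continuousAt.continuousWithinAt
    · exact hderiv u (hs.trans hu.1)
  have hy : 0 < y := hx.trans hxy
  have hz : 0 < z := hy.trans hyz
  obtain ⟨c, hc, hGc⟩ := hrolle x y hx hxy (hroot x hx rx) (hroot y hy ry)
  obtain ⟨d, hd, hGd⟩ := hrolle y z hy hyz (hroot y hy ry) (hroot z hz rz)
  have hc0 : 0 < c := hx.trans hc.1
  have hcd : c < d := hc.2.trans hd.1
  have hd0 : 0 < d := hc0.trans hcd
  have key : ∀ t, 0 < t → G t = 0 →
      ∑ i ∈ Finset.range N, a i * ((i : ℝ) - m) * t ^ ((i : ℤ) - n) = 0 := by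
    intro t ht h
    have : ∑ i ∈ Finset.range N, a i * ((i : ℝ) - m) * t ^ ((i : ℤ) - n)
        = G t * t ^ ((m : ℤ) + 1 - n) := by
      rw [hG, Finset.sum_mul]
      refine Finset.sum_congr rfl fun i _ => ?_
      rw [show (i : ℤ) - n = ((i : ℤ) - m - 1) + ((m : ℤ) + 1 - n) by ring, zpow_add₀ ht.ne']
      push_cast
      ring
    rw [this, h, zero_mul]
  have hpow : ∀ i : ℕ, i < n → d ^ ((i : ℤ) - n) < c ^ ((i : ℤ) - n) := by
    intro i hi
    obtain ⟨j, rfl⟩ := Nat.exists_eq_add_of_lt hi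
    rw [show (i : ℤ) - ((i + j + 1 : ℕ) : ℤ) = -((j + 1 : ℕ) : ℤ) by push_cast; ring,
      zpow_neg, zpow_neg, zpow_natCast, zpow_natCast]
    exact inv_strictAnti₀ (by positivity) (pow_lt_pow_left₀ hcd hc0.le (by omega))
  have hlt : ∑ i ∈ Finset.range N, a i * ((i : ℝ) - m) * c ^ ((i : ℤ) - n)
      < ∑ i ∈ Finset.range N, a i * ((i : ℝ) - m) * d ^ ((i : ℤ) - n) := by
    refine Finset.sum_lt_sum (fun i hi => ?_) ⟨0, Finset.mem_range.2 hN, ?_⟩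
    · rcases lt_or_ge i n with hin | hin
      · refine mul_le_mul_of_nonpos_left (hpow i hin).le ?_
        rcases lt_or_ge i m with him | him
        · exact mul_nonpos_of_nonneg_of_nonpos (hlow i him)
            (sub_nonpos.2 (by exact_mod_cast him.le))
        · exact mul_nonpos_of_nonpos_of_nonneg (hmid i him hin)
            (sub_nonneg.2 (by exact_mod_cast him))
      · refine mul_le_mul_of_nonneg_left ?_ (mul_nonneg (hhigh i (Finset.mem_range.1 hi) hin)
          (sub_nonneg.2 (by exact_mod_cast hmn.trans hin)))
        obtain ⟨j, rfl⟩ := Nat.exists_eq_add_of_le hin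
        rw [show ((n + j : ℕ) : ℤ) - n = (j : ℤ) by push_cast; ring, zpow_natCast, zpow_natCast]
        exact pow_le_pow_left₀ hc0.le hcd.le j
    · refine mul_lt_mul_of_neg_left (hpow 0 (hm.trans_le hmn)) ?_
      have : (0 : ℝ) < m := by exact_mod_cast hm
      refine mul_neg_of_pos_of_neg h0 ?_
      push_cast
      linarith
  rw [key c hc0 hGc, key d hd0 hGd] at hlt
  exact lt_irrefl _ hlt

theorem encard_le_two_of_forall_lt {α : Type*} [LinearOrder α] {S : Set α}
    (hS : ∀ x ∈ S, ∀ y ∈ S, ∀ z ∈ S, x < y → y < z → False) : S.encard ≤ 2 := by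
  by_contra! hcard
  obtain ⟨T, hTS, hT⟩ := Set.exists_subset_encard_eq (Order.add_one_le_of_lt hcard)
  rw [show (2 : ℕ∞) + 1 = 3 by norm_num, Set.encard_eq_three] at hT
  obtain ⟨x, y, z, hxy, hxz, hyz, rfl⟩ := hT
  have hx := hTS (show x ∈ ({x, y, z} : Set α) by simp)
  have hy := hTS (show y ∈ ({x, y, z} : Set α) by simp)
  have hz := hTS (show z ∈ ({x, y, z} : Set α) by simp)
  rcases lt_or_gt_of_ne hxy with h1 | h1 <;> rcases lt_or_gt_of_ne hxz with h2 | h2 <;>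
    rcases lt_or_gt_of_ne hyz with h3 | h3
  · exact hS x hx y hy z hz h1 h3
  · exact hS x hx z hz y hy h2 h3
  · exact lt_asymm (h1.trans h3) h2
  · exact hS z hz x hx y hy h2 h1
  · exact hS y hy x hx z hz h1 h2
  · exact lt_asymm (h3.trans h1) h2
  · exact hS y hy z hz x hx h3 h2
  · exact hS z hz y hy x hx h3 h1

/-- The coefficients of `-p h` as a polynomial in its second variable. -/
noncomputable def xiCoeff (h : ℝ) (i : ℕ) : ℝ :=
  match i with
  | 0 => xi0 h
  | 1 => xi1 h
  | 2 => xi2 h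
  | 3 => xi3 h
  | 4 => xi4 h
  | 5 => xi5 h
  | 6 => xi6 h
  | 7 => xi7 h
  | 8 => xi8 h
  | 9 => xi9 h
  | _ => 0

theorem p_eq_neg_sum_xiCoeff (h k : ℝ) :
    p h k = -∑ i ∈ Finset.range 10, xiCoeff h i * k ^ i := by
  simp [p, Finset.sum_range_succ, xiCoeff]

theorem encard_pos_roots_le_two_of_sign_pattern {h : ℝ} (hh : 0 < h) {m n : ℕ} (hm : 0 < m)
    (hmn : m ≤ n) (hlow : ∀ i < m, 0 ≤ xiCoeff h i)
    (hmid : ∀ i, m ≤ i → i < n → xiCoeff h i ≤ 0)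
    (hhigh : ∀ i < 10, n ≤ i → 0 ≤ xiCoeff h i) :
    {k : ℝ | 0 < k ∧ p h k = 0}.encard ≤ 2 := by
  refine encard_le_two_of_forall_lt fun x hx y hy z hz hxy hyz => ?_
  have hroot : ∀ k ∈ {k : ℝ | 0 < k ∧ p h k = 0},
      ∑ i ∈ Finset.range 10, xiCoeff h i * k ^ i = 0 := fun k hk =>
    neg_eq_zero.1 ((p_eq_neg_sum_xiCoeff h k).symm.trans hk.2)
  have h0 : 0 < xiCoeff h 0 := by
    simp only [xiCoeff, xi0]
    positivity
  exact not_three_pos_roots_of_sign_pattern (xiCoeff h) (by norm_num) hm hmn h0 hlow hmid hhigh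
    hx.1 hxy hyz (hroot x hx) (hroot y hy) (hroot z hz)

theorem p_neg_of_mem_Icc {h k : ℝ} (h1 : 163 / 1000 ≤ h) (h2 : h ≤ 165 / 1000) (hk : 0 < k) :
    p h k < 0 := by
  have hh : 0 < h := by linarith
  obtain ⟨u, rfl⟩ : ∃ u, k = h * u := ⟨k / h, by field_simp⟩
  have hu : 0 < u := pos_of_mul_pos_right hk hh.le
  have p2 : (163 / 1000) ^ 2 ≤ h ^ 2 := pow_le_pow_left₀ (by norm_num) h1 2
  have p3 : (163 / 1000) ^ 3 ≤ h ^ 3 := pow_le_pow_left₀ (by norm_num) h1 3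
  have p4 : (163 / 1000) ^ 4 ≤ h ^ 4 := pow_le_pow_left₀ (by norm_num) h1 4
  have p5 : (163 / 1000) ^ 5 ≤ h ^ 5 := pow_le_pow_left₀ (by norm_num) h1 5
  have q1 : (7 / 5 : ℝ) ≤ h * ((16 * h + 7) * (h + 1) ^ 3) := by
    have e : (1 : ℝ) ≤ (h + 1) ^ 3 := one_le_pow₀ (by linarith)
    nlinarith [mul_nonneg hh.le (mul_nonneg (show (0 : ℝ) ≤ 16 * h + 7 by linarith)
      (sub_nonneg.2 e))]
  have q2 : (-1 / 2 : ℝ) ≤ 4 * (3 * h + 14 * h ^ 2 + 14 * h ^ 3 - 1) * (h + 1) ^ 2 := by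
    have e : (h + 1) ^ 2 ≤ 7 / 5 := by nlinarith
    have e' : (-8 / 100 : ℝ) ≤ 3 * h + 14 * h ^ 2 + 14 * h ^ 3 - 1 := by
      norm_num at p2 p3
      linarith
    nlinarith [mul_nonneg (sub_nonneg.2 e') (sq_nonneg (h + 1))]
  have q3 : (-1 / 50 : ℝ) ≤ (h + 1) * (3 * h + 98 * h ^ 2 + 190 * h ^ 3 + 112 * h ^ 4 - 4) := by
    have e' : (-1 / 100 : ℝ) ≤ 3 * h + 98 * h ^ 2 + 190 * h ^ 3 + 112 * h ^ 4 - 4 := by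
      norm_num at p2 p3 p4
      linarith
    nlinarith [mul_nonneg (sub_nonneg.2 e') (show 0 ≤ h + 1 by linarith)]
  have q4 : (-1 / 5 : ℝ) ≤
      2 * h + 109 * h ^ 2 + 322 * h ^ 3 + 356 * h ^ 4 + 140 * h ^ 5 - 5 := by
    norm_num at p2 p3 p4 p5
    linarith
  have q5 : (1 : ℝ) ≤ 2 * (h + 1) * (5 * h + 46 * h ^ 2 + 88 * h ^ 3 + 56 * h ^ 4 - 1) := by
    have e' : (1 / 2 : ℝ) ≤ 5 * h + 46 * h ^ 2 + 88 * h ^ 3 + 56 * h ^ 4 - 1 := by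
      norm_num at p2 p3 p4
      linarith
    nlinarith [mul_nonneg (sub_nonneg.2 e') (show 0 ≤ h + 1 by linarith)]
  have q6 : (0 : ℝ) ≤ 13 * h + 64 * h ^ 2 + 104 * h ^ 3 + 56 * h ^ 4 - 1 := by
    nlinarith [pow_pos hh 3, pow_pos hh 4]
  have main : 0 < 7 / 5 * u - 1 / 2 * u ^ 2 - 1 / 50 * u ^ 3 - 1 / 5 * u ^ 4 + u ^ 5 := by
    have : 0 < 7 / 5 - 1 / 2 * u - 1 / 50 * u ^ 2 - 1 / 5 * u ^ 3 + u ^ 4 := by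
      rcases le_total u 1 with hu1 | hu1
      · have := pow_le_one₀ (n := 2) hu.le hu1
        have := pow_le_one₀ (n := 3) hu.le hu1
        have := pow_pos hu 4
        linarith
      · have := pow_le_pow_right₀ hu1 (show 1 ≤ 4 by norm_num)
        have := pow_le_pow_right₀ hu1 (show 2 ≤ 4 by norm_num)
        have := pow_le_pow_right₀ hu1 (show 3 ≤ 4 by norm_num)
        have := pow_pos hu 4
        linarith
    calc (0 : ℝ) < u * (7 / 5 - 1 / 2 * u - 1 / 50 * u ^ 2 - 1 / 5 * u ^ 3 + u ^ 4) :=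
          mul_pos hu this
      _ = _ := by ring
  have r1 := mul_le_mul_of_nonneg_right q1 hu.le
  have r2 := mul_le_mul_of_nonneg_right q2 (pow_pos hu 2).le
  have r3 := mul_le_mul_of_nonneg_right q3 (pow_pos hu 3).le
  have r4 := mul_le_mul_of_nonneg_right q4 (pow_pos hu 4).le
  have r5 := mul_le_mul_of_nonneg_right q5 (pow_pos hu 5).le
  have hlow : 0 < xi1 h * (h * u) + xi2 h * (h * u) ^ 2 + xi3 h * (h * u) ^ 3
      + xi4 h * (h * u) ^ 4 + xi5 h * (h * u) ^ 5 := by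
    have : 0 < h * ((16 * h + 7) * (h + 1) ^ 3) * u
        + 4 * (3 * h + 14 * h ^ 2 + 14 * h ^ 3 - 1) * (h + 1) ^ 2 * u ^ 2
        + (h + 1) * (3 * h + 98 * h ^ 2 + 190 * h ^ 3 + 112 * h ^ 4 - 4) * u ^ 3
        + (2 * h + 109 * h ^ 2 + 322 * h ^ 3 + 356 * h ^ 4 + 140 * h ^ 5 - 5) * u ^ 4
        + 2 * (h + 1) * (5 * h + 46 * h ^ 2 + 88 * h ^ 3 + 56 * h ^ 4 - 1) * u ^ 5 := by
      linarith
    have := mul_pos (pow_pos hh 8) this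
    simp only [xi1, xi2, xi3, xi4, xi5]
    linarith
  have s0 : 0 < xi0 h := by simp only [xi0]; positivity
  have s6 : 0 ≤ xi6 h * (h * u) ^ 6 := by simp only [xi6]; positivity
  have s7 : 0 ≤ xi7 h * (h * u) ^ 7 := by simp only [xi7]; positivity
  have s8 : 0 ≤ xi8 h * (h * u) ^ 8 := by simp only [xi8]; positivity
  have s9 : 0 ≤ xi9 h * (h * u) ^ 9 := by simp only [xi9]; positivity
  unfold p
  linarith

theorem xi2_nonpos {h : ℝ} (hh : 0 < h) (h1 : h ≤ 163 / 1000) : xi2 h ≤ 0 := by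
  have p2 := pow_le_pow_left₀ hh.le h1 2
  have p3 := pow_le_pow_left₀ hh.le h1 3
  have : 3 * h + 14 * h ^ 2 + 14 * h ^ 3 - 1 ≤ 0 := by
    norm_num at p2 p3
    linarith
  exact mul_nonpos_of_nonpos_of_nonneg (mul_nonpos_of_nonneg_of_nonpos (by positivity) this)
    (by positivity)

theorem xi3_nonpos {h : ℝ} (hh : 0 < h) (h1 : h ≤ 163 / 1000) : xi3 h ≤ 0 := by
  have p2 := pow_le_pow_left₀ hh.le h1 2
  have p3 := pow_le_pow_left₀ hh.le h1 3
  have p4 := pow_le_pow_left₀ hh.le h1 4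
  refine mul_nonpos_of_nonneg_of_nonpos (by positivity) ?_
  norm_num at p2 p3 p4
  linarith

theorem xi4_nonpos {h : ℝ} (hh : 0 < h) (h1 : h ≤ 163 / 1000) : xi4 h ≤ 0 := by
  have p2 := pow_le_pow_left₀ hh.le h1 2
  have p3 := pow_le_pow_left₀ hh.le h1 3
  have p4 := pow_le_pow_left₀ hh.le h1 4
  have p5 := pow_le_pow_left₀ hh.le h1 5
  refine mul_nonpos_of_nonneg_of_nonpos (by positivity) ?_
  norm_num at p2 p3 p4 p5
  linarith

theorem xi3_nonneg {h : ℝ} (h1 : 165 / 1000 ≤ h) : 0 ≤ xi3 h := by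
  have hh : 0 < h := by linarith
  have p2 := pow_le_pow_left₀ (by norm_num) h1 2
  have p3 := pow_le_pow_left₀ (by norm_num) h1 3
  have p4 := pow_le_pow_left₀ (by norm_num) h1 4
  refine mul_nonneg (by positivity) ?_
  norm_num at p2 p3 p4
  linarith

theorem xi4_nonneg {h : ℝ} (h1 : 165 / 1000 ≤ h) : 0 ≤ xi4 h := by
  have hh : 0 < h := by linarith
  have p2 := pow_le_pow_left₀ (by norm_num) h1 2
  have p3 := pow_le_pow_left₀ (by norm_num) h1 3
  have p4 := pow_le_pow_left₀ (by norm_num) h1 4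
  have p5 := pow_le_pow_left₀ (by norm_num) h1 5
  refine mul_nonneg (by positivity) ?_
  norm_num at p2 p3 p4 p5
  linarith

theorem xi5_nonneg {h : ℝ} (h1 : 1 / 10 ≤ h) : 0 ≤ xi5 h := by
  have hh : 0 < h := by linarith
  have p2 := pow_le_pow_left₀ (by norm_num) h1 2
  have p3 := pow_le_pow_left₀ (by norm_num) h1 3
  have p4 := pow_le_pow_left₀ (by norm_num) h1 4
  refine mul_nonneg (by positivity) ?_
  norm_num at p2 p3 p4
  linarith

theorem xi5_nonpos {h : ℝ} (hh : 0 < h) (h1 : h ≤ 7 / 100) : xi5 h ≤ 0 := by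
  have p2 := pow_le_pow_left₀ hh.le h1 2
  have p3 := pow_le_pow_left₀ hh.le h1 3
  have p4 := pow_le_pow_left₀ hh.le h1 4
  refine mul_nonpos_of_nonneg_of_nonpos (by positivity) ?_
  norm_num at p2 p3 p4
  linarith

theorem xi6_nonneg {h : ℝ} (h1 : 7 / 100 ≤ h) : 0 ≤ xi6 h := by
  have hh : 0 < h := by linarith
  have p2 := pow_le_pow_left₀ (by norm_num) h1 2
  have p3 := pow_pos hh 3
  have p4 := pow_pos hh 4
  refine mul_nonneg (by positivity) ?_
  norm_num at p2
  linarith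

theorem roots_in_k_atMost_two (h : ℝ) (hh : 0 < h) :
    {k : ℝ | 0 < k ∧ p h k = 0}.encard ≤ 2 := by
  have s0 : 0 ≤ xi0 h := by simp only [xi0]; positivity
  have s1 : 0 ≤ xi1 h := by simp only [xi1]; positivity
  have s7 : 0 ≤ xi7 h := by simp only [xi7]; positivity
  have s8 : 0 ≤ xi8 h := by simp only [xi8]; positivity
  have s9 : 0 ≤ xi9 h := by simp only [xi9]; positivity
  rcases le_total h (163 / 1000) with h1 | h1
  · have s2 := xi2_nonpos hh h1
    have s3 := xi3_nonpos hh h1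
    have s4 := xi4_nonpos hh h1
    have pattern : ∀ n, 5 ≤ n → n ≤ 7 → (∀ i, 5 ≤ i → i < n → xiCoeff h i ≤ 0) →
        (∀ i < 7, n ≤ i → 0 ≤ xiCoeff h i) →
        {k : ℝ | 0 < k ∧ p h k = 0}.encard ≤ 2 := by
      intro n hn hn' hneg hpos
      refine encard_pos_roots_le_two_of_sign_pattern hh (m := 2) (n := n) (by norm_num)
        (by omega) (fun i hi => ?_) (fun i hi hi' => ?_) fun i hi hi' => ?_
      · interval_cases i <;> assumption
      · rcases lt_or_ge i 5 with h5 | h5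
        · interval_cases i <;> assumption
        · exact hneg i h5 hi'
      · rcases lt_or_ge i 7 with h7 | h7
        · exact hpos i h7 hi'
        · interval_cases i <;> assumption
    rcases le_total h (7 / 100) with h7 | h7
    · have s5 := xi5_nonpos hh h7
      rcases le_total (xi6 h) 0 with s6 | s6
      · refine pattern 7 (by norm_num) le_rfl (fun i hi hi' => ?_) fun i hi hi' => ?_
        · interval_cases i <;> assumption
        · omega
      · refine pattern 6 (by norm_num) (by norm_num) (fun i hi hi' => ?_) fun i hi hi' => ?_ <;>
          interval_cases i <;> assumption
    · have s6 := xi6_nonneg h7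
      rcases le_total (xi5 h) 0 with s5 | s5
      · refine pattern 6 (by norm_num) (by norm_num) (fun i hi hi' => ?_) fun i hi hi' => ?_ <;>
          interval_cases i <;> assumption
      · refine pattern 5 le_rfl (by norm_num) (fun i hi hi' => ?_) fun i hi hi' => ?_
        · omega
        · interval_cases i <;> assumption
  · rcases le_total h (165 / 1000) with h2 | h2
    · have : {k : ℝ | 0 < k ∧ p h k = 0} = ∅ :=
        Set.eq_empty_of_forall_notMem fun k hk => (p_neg_of_mem_Icc h1 h2 hk.1).ne hk.2
      simp [this]
    · have s3 := xi3_nonneg h2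
      have s4 := xi4_nonneg h2
      have s5 := xi5_nonneg (show 1 / 10 ≤ h by linarith)
      have s6 := xi6_nonneg (show 7 / 100 ≤ h by linarith)
      rcases le_total (xi2 h) 0 with s2 | s2
      · refine encard_pos_roots_le_two_of_sign_pattern hh (m := 2) (n := 3) (by norm_num)
          (by norm_num) (fun i hi => ?_) (fun i hi hi' => ?_) fun i hi hi' => ?_ <;>
          interval_cases i <;> assumption
      · refine encard_pos_roots_le_two_of_sign_pattern hh (m := 2) (n := 2) (by norm_num)
          (by norm_num) (fun i hi => ?_) (fun i hi hi' => ?_) fun i hi hi' => ?_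
        · interval_cases i <;> assumption
        · omega
        · interval_cases i <;> assumption
end

section
/- For every fixed k > 0, the set {h > 0 : p(h,k) = 0} has at most two elements. -/
/-- Rolle's theorem for `x ^ (-a) * ∑ j, c j * x ^ j`: between two positive zeros of a polynomial
function lies a zero of its image under `x * d/dx - a`. -/
theorem exists_sum_sub_mul_eq_zero (s : Finset ℕ) (c : ℕ → ℝ) (a : ℕ) {x y : ℝ} (hx : 0 < x)
    (hxy : x < y) (fx : ∑ j ∈ s, c j * x ^ j = 0) (fy : ∑ j ∈ s, c j * y ^ j = 0) :
    ∃ z, x < z ∧ z < y ∧ ∑ j ∈ s, (((j : ℝ) - a) * c j) * z ^ j = 0 := by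
  have hderiv : ∀ z : ℝ, z ≠ 0 → HasDerivAt (fun t : ℝ => ∑ j ∈ s, c j * t ^ ((j : ℤ) - a))
      (∑ j ∈ s, c j * ((((j : ℤ) - a : ℤ) : ℝ) * z ^ ((j : ℤ) - a - 1))) z := fun z hz =>
    HasDerivAt.fun_sum fun j _ => (hasDerivAt_zpow ((j : ℤ) - a) z (Or.inl hz)).const_mul (c j)
  have hval : ∀ z : ℝ, z ≠ 0 → ∑ j ∈ s, c j * z ^ ((j : ℤ) - a)
      = (∑ j ∈ s, c j * z ^ j) / z ^ a := fun z hz => by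
    rw [Finset.sum_div]
    refine Finset.sum_congr rfl fun j _ => ?_
    rw [zpow_sub₀ hz, zpow_natCast, zpow_natCast, mul_div_assoc]
  have hne : ∀ z ∈ Set.Icc x y, z ≠ 0 := fun z hz => (hx.trans_le hz.1).ne'
  obtain ⟨z, hz, h0⟩ := exists_hasDerivAt_eq_zero hxy
    (fun z hz => (hderiv z (hne z hz)).continuousAt.continuousWithinAt)
    (by rw [hval x hx.ne', hval y (hx.trans hxy).ne', fx, fy, zero_div, zero_div])
    (fun z hz => hderiv z (hne z (Set.Ioo_subset_Icc_self hz)))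
  have hz0 : z ≠ 0 := hne z (Set.Ioo_subset_Icc_self hz)
  refine ⟨z, hz.1, hz.2, ?_⟩
  calc ∑ j ∈ s, (((j : ℝ) - a) * c j) * z ^ j
      = z ^ ((a : ℤ) + 1) *
          ∑ j ∈ s, c j * ((((j : ℤ) - a : ℤ) : ℝ) * z ^ ((j : ℤ) - a - 1)) := by
        rw [Finset.mul_sum]
        refine Finset.sum_congr rfl fun j _ => ?_
        have : z ^ j = z ^ ((a : ℤ) + 1) * z ^ ((j : ℤ) - a - 1) := by
          rw [← zpow_add₀ hz0, ← zpow_natCast]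
          congr 1
          ring
        rw [this]
        push_cast
        ring
    _ = 0 := by rw [h0, mul_zero]

/-- Descartes' rule of signs for two sign changes, located at the exponents `a ≤ b`. -/
theorem encard_pos_zeros_le_two (n : ℕ) (c : ℕ → ℝ) {a b : ℕ} (ha : 0 < a) (hab : a ≤ b)
    (hc₀ : 0 < c 0) (hneg : ∀ j < n + 1, a ≤ j → j < b → c j ≤ 0)
    (hnonneg : ∀ j < n + 1, j < a ∨ b ≤ j → 0 ≤ c j) :
    {x : ℝ | 0 < x ∧ ∑ j ∈ Finset.range (n + 1), c j * x ^ j = 0}.encard ≤ 2 := by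
  have hc : ∀ j ∈ Finset.range (n + 1), 0 ≤ ((j : ℝ) - b) * (((j : ℝ) - a) * c j) := by
    intro j hj
    rw [Finset.mem_range] at hj
    have hab' : (a : ℝ) ≤ b := by exact_mod_cast hab
    rcases lt_or_ge j a with hja | hja
    · have hja' : (j : ℝ) < a := by exact_mod_cast hja
      exact mul_nonneg_of_nonpos_of_nonpos (by linarith)
        (mul_nonpos_of_nonpos_of_nonneg (by linarith) (hnonneg j hj (Or.inl hja)))
    have hja' : (a : ℝ) ≤ j := by exact_mod_cast hja
    rcases lt_or_ge j b with hjb | hjb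
    · have hjb' : (j : ℝ) < b := by exact_mod_cast hjb
      exact mul_nonneg_of_nonpos_of_nonpos (by linarith)
        (mul_nonpos_of_nonneg_of_nonpos (by linarith) (hneg j hj hja hjb))
    · have hjb' : (b : ℝ) ≤ j := by exact_mod_cast hjb
      exact mul_nonneg (by linarith) (mul_nonneg (by linarith) (hnonneg j hj (Or.inr hjb)))
  have key : ∀ x y z : ℝ, 0 < x → x < y → y < z →
      ∑ j ∈ Finset.range (n + 1), c j * x ^ j = 0 →
      ∑ j ∈ Finset.range (n + 1), c j * y ^ j = 0 →
      ∑ j ∈ Finset.range (n + 1), c j * z ^ j = 0 → False := by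
    intro x y z hx hxy hyz fx fy fz
    obtain ⟨u, hxu, huy, fu⟩ := exists_sum_sub_mul_eq_zero _ c a hx hxy fx fy
    obtain ⟨v, hyv, -, fv⟩ := exists_sum_sub_mul_eq_zero _ c a (hx.trans hxy) hyz fy fz
    have hu : 0 < u := hx.trans hxu
    obtain ⟨w, huw, -, fw⟩ := exists_sum_sub_mul_eq_zero _ _ b hu (huy.trans hyv) fu fv
    refine (Finset.sum_pos' (fun j hj => ?_) ⟨0, by simp, ?_⟩).ne' fw
    · exact mul_nonneg (hc j hj) (pow_nonneg (hu.trans huw).le j)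
    · have ha' : (0 : ℝ) < a := by exact_mod_cast ha
      have hb' : (0 : ℝ) < b := by exact_mod_cast ha.trans_le hab
      have : 0 < (b : ℝ) * (a * c 0) := by positivity
      simpa using this
  by_contra! hcard
  obtain ⟨t, hts, ht⟩ := Set.exists_subset_encard_eq (Order.add_one_le_of_lt hcard)
  obtain ⟨x, y, z, hxy, hxz, hyz, rfl⟩ := Set.encard_eq_three.mp (ht.trans (by norm_num))
  obtain ⟨hx, fx⟩ := hts (show x ∈ ({x, y, z} : Set ℝ) by simp)
  obtain ⟨hy, fy⟩ := hts (show y ∈ ({x, y, z} : Set ℝ) by simp)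
  obtain ⟨hz, fz⟩ := hts (show z ∈ ({x, y, z} : Set ℝ) by simp)
  rcases lt_or_gt_of_ne hxy with h₁ | h₁ <;> rcases lt_or_gt_of_ne hxz with h₂ | h₂ <;>
    rcases lt_or_gt_of_ne hyz with h₃ | h₃
  · exact key x y z hx h₁ h₃ fx fy fz
  · exact key x z y hx h₂ h₃ fx fz fy
  · exact key z x y hz h₂ h₁ fz fx fy
  · exact key z x y hz h₂ h₁ fz fx fy
  · exact key y x z hy h₁ h₂ fy fx fz
  · exact key y x z hy h₁ h₂ fy fx fz
  · exact key y z x hy h₃ h₂ fy fz fx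
  · exact key z y x hz h₃ h₁ fz fy fx

/-- The coefficient of `h ^ j` in `-p h k`. -/
noncomputable def hCoeff (k : ℝ) : ℕ → ℝ
  | 0 => k ^ 9
  | 1 => k ^ 8 * (4 + 3 * k)
  | 2 => k ^ 6 * (-1 + 9 * k + 16 * k ^ 2 + 3 * k ^ 3)
  | 3 => k ^ 5 * (-2 + 12 * k + 43 * k ^ 2 + 22 * k ^ 3 + k ^ 4)
  | 4 => k ^ 4 * (-5 + 8 * k + 77 * k ^ 2 + 76 * k ^ 3 + 12 * k ^ 4)
  | 5 => k ^ 3 * (-4 + 2 * k + 102 * k ^ 2 + 168 * k ^ 3 + 58 * k ^ 4 + 2 * k ^ 5)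
  | 6 => k ^ 2 * (-4 - k + 109 * k ^ 2 + 268 * k ^ 3 + 160 * k ^ 4 + 16 * k ^ 5)
  | 7 => k ^ 2 * (4 + 101 * k + 322 * k ^ 2 + 288 * k ^ 3 + 56 * k ^ 4)
  | 8 => k * (7 + 76 * k + 288 * k ^ 2 + 356 * k ^ 3 + 112 * k ^ 4)
  | 9 => 2 + 37 * k + 180 * k ^ 2 + 302 * k ^ 3 + 140 * k ^ 4
  | 10 => 8 + 69 * k + 168 * k ^ 2 + 112 * k ^ 3
  | 11 => 12 + 55 * k + 56 * k ^ 2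
  | 12 => 8 + 16 * k
  | 13 => 2
  | _ => 0

theorem p_eq_neg_sum_hCoeff (h k : ℝ) :
    p h k = -∑ j ∈ Finset.range (13 + 1), hCoeff k j * h ^ j := by
  simp only [Finset.sum_range_succ, Finset.sum_range_zero, hCoeff, p, xi0, xi1, xi2, xi3, xi4, xi5,
    xi6, xi7, xi8, xi9]
  ring

/-! As `k` increases, the coefficients with index `2`, `3`, `6`, `5`, `4` become nonnegative in this
order, so the negative coefficients always form a block of consecutive indices. -/

theorem hCoeff_two_nonneg {k : ℝ} (hk : 0 < k) (h : 0 ≤ hCoeff k 3) : 0 ≤ hCoeff k 2 := by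
  rcases le_total k (1 / 10) with hq | hq
  · refine absurd h (not_le.mpr (mul_neg_of_pos_of_neg (by positivity) ?_))
    have h₂ : k ^ 2 ≤ (1 / 10) ^ 2 := by gcongr
    have h₃ : k ^ 3 ≤ (1 / 10) ^ 3 := by gcongr
    have h₄ : k ^ 4 ≤ (1 / 10) ^ 4 := by gcongr
    have h₅ : k ^ 5 ≤ (1 / 10) ^ 5 := by gcongr
    norm_num at h₂ h₃ h₄ h₅
    linarith
  · refine mul_nonneg (by positivity) ?_
    have h₁ : (1 / 10) * k ≤ k ^ 2 := by nlinarith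
    have h₂ : (1 / 10) ^ 2 ≤ k ^ 2 := by gcongr
    have h₃ : (1 / 10) ^ 3 ≤ k ^ 3 := by gcongr
    have h₄ : (1 / 10) ^ 4 ≤ k ^ 4 := by gcongr
    have h₅ : (1 / 10) ^ 5 ≤ k ^ 5 := by gcongr
    norm_num at h₁ h₂ h₃ h₄ h₅
    linarith

theorem hCoeff_three_nonneg {k : ℝ} (hk : 0 < k) (h : 0 ≤ hCoeff k 6) : 0 ≤ hCoeff k 3 := by
  rcases le_total k (3 / 20) with hq | hq
  · refine absurd h (not_le.mpr (mul_neg_of_pos_of_neg (by positivity) ?_))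
    have h₂ : k ^ 2 ≤ (3 / 20) ^ 2 := by gcongr
    have h₃ : k ^ 3 ≤ (3 / 20) ^ 3 := by gcongr
    have h₄ : k ^ 4 ≤ (3 / 20) ^ 4 := by gcongr
    have h₅ : k ^ 5 ≤ (3 / 20) ^ 5 := by gcongr
    norm_num at h₂ h₃ h₄ h₅
    linarith
  · refine mul_nonneg (by positivity) ?_
    have h₁ : (3 / 20) * k ≤ k ^ 2 := by nlinarith
    have h₂ : (3 / 20) ^ 2 ≤ k ^ 2 := by gcongr
    have h₃ : (3 / 20) ^ 3 ≤ k ^ 3 := by gcongr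
    have h₄ : (3 / 20) ^ 4 ≤ k ^ 4 := by gcongr
    have h₅ : (3 / 20) ^ 5 ≤ k ^ 5 := by gcongr
    norm_num at h₁ h₂ h₃ h₄ h₅
    linarith

theorem hCoeff_six_nonneg {k : ℝ} (hk : 0 < k) (h : 0 ≤ hCoeff k 5) : 0 ≤ hCoeff k 6 := by
  rcases le_total k (33 / 200) with hq | hq
  · refine absurd h (not_le.mpr (mul_neg_of_pos_of_neg (by positivity) ?_))
    have h₂ : k ^ 2 ≤ (33 / 200) ^ 2 := by gcongr
    have h₃ : k ^ 3 ≤ (33 / 200) ^ 3 := by gcongr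
    have h₄ : k ^ 4 ≤ (33 / 200) ^ 4 := by gcongr
    have h₅ : k ^ 5 ≤ (33 / 200) ^ 5 := by gcongr
    norm_num at h₂ h₃ h₄ h₅
    linarith
  · refine mul_nonneg (by positivity) ?_
    have h₁ : (33 / 200) * k ≤ k ^ 2 := by nlinarith
    have h₂ : (33 / 200) ^ 2 ≤ k ^ 2 := by gcongr
    have h₃ : (33 / 200) ^ 3 ≤ k ^ 3 := by gcongr
    have h₄ : (33 / 200) ^ 4 ≤ k ^ 4 := by gcongr
    have h₅ : (33 / 200) ^ 5 ≤ k ^ 5 := by gcongr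
    norm_num at h₁ h₂ h₃ h₄ h₅
    linarith

theorem hCoeff_five_nonneg {k : ℝ} (hk : 0 < k) (h : 0 ≤ hCoeff k 4) : 0 ≤ hCoeff k 5 := by
  rcases le_total k (9 / 50) with hq | hq
  · refine absurd h (not_le.mpr (mul_neg_of_pos_of_neg (by positivity) ?_))
    have h₂ : k ^ 2 ≤ (9 / 50) ^ 2 := by gcongr
    have h₃ : k ^ 3 ≤ (9 / 50) ^ 3 := by gcongr
    have h₄ : k ^ 4 ≤ (9 / 50) ^ 4 := by gcongr
    have h₅ : k ^ 5 ≤ (9 / 50) ^ 5 := by gcongr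
    norm_num at h₂ h₃ h₄ h₅
    linarith
  · refine mul_nonneg (by positivity) ?_
    have h₁ : (9 / 50) * k ≤ k ^ 2 := by nlinarith
    have h₂ : (9 / 50) ^ 2 ≤ k ^ 2 := by gcongr
    have h₃ : (9 / 50) ^ 3 ≤ k ^ 3 := by gcongr
    have h₄ : (9 / 50) ^ 4 ≤ k ^ 4 := by gcongr
    have h₅ : (9 / 50) ^ 5 ≤ k ^ 5 := by gcongr
    norm_num at h₁ h₂ h₃ h₄ h₅
    linarith

theorem hCoeff_nonneg {k : ℝ} (hk : 0 < k) {j : ℕ} (hj : j < 2 ∨ 7 ≤ j) : 0 ≤ hCoeff k j := by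
  unfold hCoeff
  split <;> first | omega | positivity

theorem roots_in_h_atMost_two (k : ℝ) (hk : 0 < k) :
    {h : ℝ | 0 < h ∧ p h k = 0}.encard ≤ 2 := by
  simp only [p_eq_neg_sum_hCoeff, neg_eq_zero]
  have hc₀ : 0 < hCoeff k 0 := by simp only [hCoeff]; positivity
  have hends : ∀ j, j < 2 ∨ 7 ≤ j → 0 ≤ hCoeff k j := fun j => hCoeff_nonneg hk
  have h₂ := hCoeff_two_nonneg hk
  have h₃ := hCoeff_three_nonneg hk
  have h₆ := hCoeff_six_nonneg hk
  have h₅ := hCoeff_five_nonneg hk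
  obtain ⟨a, b, ha, hab, hneg, hnonneg⟩ : ∃ a b : ℕ, 0 < a ∧ a ≤ b ∧
      (∀ j < 13 + 1, a ≤ j → j < b → hCoeff k j ≤ 0) ∧
      ∀ j < 13 + 1, j < a ∨ b ≤ j → 0 ≤ hCoeff k j := by
    by_cases c₂ : 0 ≤ hCoeff k 2
    · by_cases c₃ : 0 ≤ hCoeff k 3
      · by_cases c₆ : 0 ≤ hCoeff k 6
        · by_cases c₅ : 0 ≤ hCoeff k 5
          · by_cases c₄ : 0 ≤ hCoeff k 4
            · refine ⟨1, 1, by norm_num, le_rfl, by omega, fun j _ _ => ?_⟩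
              grind
            · refine ⟨4, 5, by norm_num, by norm_num, ?_, ?_⟩ <;> grind
          · refine ⟨4, 6, by norm_num, by norm_num, ?_, ?_⟩ <;> grind
        · refine ⟨4, 7, by norm_num, by norm_num, ?_, ?_⟩ <;> grind
      · refine ⟨3, 7, by norm_num, by norm_num, ?_, ?_⟩ <;> grind
    · refine ⟨2, 7, by norm_num, by norm_num, ?_, ?_⟩ <;> grind
  exact encard_pos_zeros_le_two 13 _ ha hab hc₀ hneg hnonneg
end

section
/- For every a > 0 such that there exists k > 0 with p(a,k) > 0, the set {k > 0 : p(a,k) = 0} has exactly two elements. (This expresses that each vertical line strictly inside the semi-cubic hyponormality region meets its boundary in exactly two points.) -/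
/-- A real polynomial whose coefficients are nonpositive below degree `m` and nonnegative from
degree `m` on, with negative constant term, has at most one positive root. -/
lemma not_two_pos_roots_of_one_sign_change {n m : ℕ} (hn : 0 < n) (hm : 0 < m) (c : ℕ → ℝ)
    (h0 : c 0 < 0) (hlow : ∀ i < n, i < m → c i ≤ 0) (hhigh : ∀ i < n, m ≤ i → 0 ≤ c i)
    {x y : ℝ} (hx : 0 < x) (hxy : x < y)
    (hgx : ∑ i ∈ Finset.range n, c i * x ^ i = 0) :
    ∑ i ∈ Finset.range n, c i * y ^ i ≠ 0 := by
  intro hgy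
  have hy : 0 < y := hx.trans hxy
  have key : ∑ i ∈ Finset.range n, c i * (x ^ i * y ^ m - x ^ m * y ^ i) = 0 := by
    calc ∑ i ∈ Finset.range n, c i * (x ^ i * y ^ m - x ^ m * y ^ i)
        = (∑ i ∈ Finset.range n, c i * x ^ i) * y ^ m
          - (∑ i ∈ Finset.range n, c i * y ^ i) * x ^ m := by
          rw [Finset.sum_mul, Finset.sum_mul, ← Finset.sum_sub_distrib]
          exact Finset.sum_congr rfl fun i _ => by ring
      _ = 0 := by rw [hgx, hgy]; ring
  have hneg : ∑ i ∈ Finset.range n, c i * (x ^ i * y ^ m - x ^ m * y ^ i) < 0 := by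
    refine Finset.sum_neg' (fun i hi => ?_) ⟨0, Finset.mem_range.2 hn, ?_⟩
    · have hi' := Finset.mem_range.1 hi
      rcases lt_or_ge i m with him | him
      · refine mul_nonpos_of_nonpos_of_nonneg (hlow i hi' him) ?_
        obtain ⟨d, rfl⟩ := Nat.exists_eq_add_of_le him.le
        have hd : x ^ d ≤ y ^ d := pow_le_pow_left₀ hx.le hxy.le d
        have hmul : 0 ≤ x ^ i * y ^ i * (y ^ d - x ^ d) := by
          have := sub_nonneg.2 hd
          positivity
        calc (0 : ℝ) ≤ x ^ i * y ^ i * (y ^ d - x ^ d) := hmul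
          _ = x ^ i * y ^ (i + d) - x ^ (i + d) * y ^ i := by ring
      · refine mul_nonpos_of_nonneg_of_nonpos (hhigh i hi' him) ?_
        obtain ⟨d, rfl⟩ := Nat.exists_eq_add_of_le him
        have hd : x ^ d ≤ y ^ d := pow_le_pow_left₀ hx.le hxy.le d
        have hmul : 0 ≤ x ^ m * y ^ m * (y ^ d - x ^ d) := by
          have := sub_nonneg.2 hd
          positivity
        have : x ^ m * y ^ m * (y ^ d - x ^ d)
          = -(x ^ (m + d) * y ^ m - x ^ m * y ^ (m + d)) := by ring
        linarith
    · refine mul_neg_of_neg_of_pos h0 ?_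
      have := pow_lt_pow_left₀ hxy hx.le hm.ne'
      simp only [pow_zero, one_mul, mul_one]
      linarith
  exact hneg.ne key

/-- Rolle's theorem for `k ↦ f k / k ^ 2`. -/
lemma exists_deriv_div_sq_eq_zero {f f' : ℝ → ℝ} (hf : ∀ k, HasDerivAt f (f' k) k)
    {u v : ℝ} (hu : 0 < u) (huv : u < v) (hfu : f u = 0) (hfv : f v = 0) :
    ∃ z ∈ Set.Ioo u v, z * f' z - 2 * f z = 0 := by
  have hderiv : ∀ k : ℝ, 0 < k → HasDerivAt (fun k => f k / k ^ 2)
      ((f' k * k ^ 2 - f k * (2 * k)) / (k ^ 2) ^ 2) k := fun k hk => by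
    have hsq : HasDerivAt (fun k : ℝ => k ^ 2) (2 * k) k := by simpa using hasDerivAt_pow 2 k
    exact (hf k).fun_div hsq (by positivity)
  obtain ⟨z, hz, hz0⟩ := exists_hasDerivAt_eq_zero huv
    (fun k hk => (hderiv k (hu.trans_le hk.1)).continuousAt.continuousWithinAt)
    (by simp [hfu, hfv])
    (fun k hk => hderiv k (hu.trans hk.1))
  have hzpos : 0 < z := hu.trans hz.1
  refine ⟨z, hz, ?_⟩
  rw [div_eq_zero_iff, or_iff_left (by positivity)] at hz0
  have : z * (z * f' z - 2 * f z) = 0 := by linarith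
  exact (mul_eq_zero.1 this).resolve_left hzpos.ne'

/-- If the coefficients `c i`, `i ≠ 2`, of a real polynomial change sign exactly twice, at degree
`2` and at degree `m`, then it has at most two positive roots. -/
lemma no_three_pos_roots {n m : ℕ} (hn : 0 < n) (hm : 2 < m) (c : ℕ → ℝ)
    (h0 : 0 < c 0) (h1 : 0 ≤ c 1) (hlow : ∀ i < n, 2 < i → i < m → c i ≤ 0)
    (hhigh : ∀ i < n, m ≤ i → 0 ≤ c i) {u v w : ℝ} (hu : 0 < u) (huv : u < v) (hvw : v < w)
    (hcu : ∑ i ∈ Finset.range n, c i * u ^ i = 0) (hcv : ∑ i ∈ Finset.range n, c i * v ^ i = 0) :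
    ∑ i ∈ Finset.range n, c i * w ^ i ≠ 0 := by
  intro hcw
  have hderiv : ∀ k : ℝ, HasDerivAt (fun k => ∑ i ∈ Finset.range n, c i * k ^ i)
      (∑ i ∈ Finset.range n, c i * (i * k ^ (i - 1))) k := fun k =>
    HasDerivAt.fun_sum fun i _ => (hasDerivAt_pow i k).const_mul (c i)
  have hcomb : ∀ k : ℝ, k * (∑ i ∈ Finset.range n, c i * (i * k ^ (i - 1)))
      - 2 * (∑ i ∈ Finset.range n, c i * k ^ i)
      = ∑ i ∈ Finset.range n, (((i : ℝ) - 2) * c i) * k ^ i := fun k => by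
    rw [Finset.mul_sum, Finset.mul_sum, ← Finset.sum_sub_distrib]
    refine Finset.sum_congr rfl fun i _ => ?_
    rcases i with _ | i
    · simp
    · rw [Nat.add_sub_cancel]; push_cast; ring
  obtain ⟨x, hx, hx0⟩ := exists_deriv_div_sq_eq_zero hderiv hu huv hcu hcv
  obtain ⟨y, hy, hy0⟩ := exists_deriv_div_sq_eq_zero hderiv (hu.trans huv) hvw hcv hcw
  rw [hcomb] at hx0 hy0
  refine not_two_pos_roots_of_one_sign_change hn (by omega : 0 < m) _ ?_ ?_ ?_
    (hu.trans hx.1) (hx.2.trans hy.1) hx0 hy0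
  · push_cast; linarith
  · intro i hi him
    rcases lt_trichotomy i 2 with h | rfl | h
    · interval_cases i <;> push_cast <;> linarith
    · simp
    · refine mul_nonpos_of_nonneg_of_nonpos ?_ (hlow i hi h him)
      have : (2 : ℝ) < i := by exact_mod_cast h
      linarith
  · intro i hi him
    refine mul_nonneg ?_ (hhigh i hi him)
    have : (2 : ℝ) < i := by exact_mod_cast hm.trans_le him
    linarith

/-- The coefficients `ξ_i(h)` as a sequence. -/
noncomputable def xiSeq (h : ℝ) : ℕ → ℝ
  | 0 => xi0 h
  | 1 => xi1 h
  | 2 => xi2 h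
  | 3 => xi3 h
  | 4 => xi4 h
  | 5 => xi5 h
  | 6 => xi6 h
  | 7 => xi7 h
  | 8 => xi8 h
  | 9 => xi9 h
  | _ => 0

lemma p_eq_neg_sum_xiSeq (h k : ℝ) :
    p h k = -∑ i ∈ Finset.range 10, xiSeq h i * k ^ i := by
  simp [p, xiSeq, Finset.sum_range_succ]

lemma continuous_p_s13 (h : ℝ) : Continuous (p h) := by
  unfold p
  fun_prop

lemma p_zero_neg {h : ℝ} (hh : 0 < h) : p h 0 < 0 := by
  have : 0 < xi0 h := by unfold xi0; positivity
  simpa [p] using this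

lemma p_neg_of_ge {h k : ℝ} (hh : 4 / 25 ≤ h) (hk : 0 < k) : p h k < 0 := by
  have hpos : 0 < h := by linarith
  obtain ⟨t, rfl⟩ : ∃ t, k = h * t := ⟨k / h, by field_simp⟩
  have ht : 0 < t := by
    by_contra hcon
    nlinarith
  have c0 : 1 / 2 ≤ 2*h*(h+1)^4 := by
    have : 2*(4/25)*(4/25+1)^4 ≤ 2*h*(h+1)^4 := by gcongr
    norm_num at this
    linarith
  have c1 : 2 ≤ h*(16*h+7)*(h+1)^3 := by
    have : (4/25)*(16*(4/25)+7)*(4/25+1)^3 ≤ h*(16*h+7)*(h+1)^3 := by gcongr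
    norm_num at this
    linarith
  obtain ⟨u, hu⟩ : ∃ u, h = 4 / 25 + u := ⟨h - 4 / 25, by ring⟩
  have hu0 : 0 ≤ u := by linarith
  have c2 : -(3 / 5) ≤ 4*(3*h+14*h^2+14*h^3-1)*(h+1)^2 := by
    rw [← sub_nonneg, hu]; ring_nf; positivity
  have c3 : -(1 / 5) ≤ (h+1)*(3*h+98*h^2+190*h^3+112*h^4-4) := by
    rw [← sub_nonneg, hu]; ring_nf; positivity
  have c4 : -(2 / 5) ≤ 2*h+109*h^2+322*h^3+356*h^4+140*h^5-5 := by
    rw [← sub_nonneg, hu]; ring_nf; positivity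
  have c5 : 2 ≤ 2*(h+1)*(5*h+46*h^2+88*h^3+56*h^4-1) := by
    rw [← sub_nonneg, hu]; ring_nf; positivity
  have c6 : 0 ≤ (h+1)*(13*h+64*h^2+104*h^3+56*h^4-1) := by
    rw [hu]; ring_nf; positivity
  have middle : ∀ i, 1 ≤ i → i ≤ 5 → t ^ i ≤ t + t ^ 5 := fun i hi hi' => by
    rcases le_total t 1 with h1 | h1
    · have : t ^ i ≤ t ^ 1 := pow_le_pow_of_le_one ht.le h1 hi
      have : 0 < t ^ 5 := by positivity
      linarith
    · have : t ^ i ≤ t ^ 5 := pow_le_pow_right₀ h1 hi'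
      linarith
  have m2 := middle 2 (by norm_num) (by norm_num)
  have m3 := middle 3 (by norm_num) (by norm_num)
  have m4 := middle 4 (by norm_num) (by norm_num)
  have d1 := mul_le_mul_of_nonneg_right c1 ht.le
  have d2 := mul_le_mul_of_nonneg_right c2 (pow_pos ht 2).le
  have d3 := mul_le_mul_of_nonneg_right c3 (pow_pos ht 3).le
  have d4 := mul_le_mul_of_nonneg_right c4 (pow_pos ht 4).le
  have d5 := mul_le_mul_of_nonneg_right c5 (pow_pos ht 5).le
  have d6 := mul_nonneg c6 (pow_pos ht 6).le
  have ht5 : 0 < t ^ 5 := by positivity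
  have hsum : 0 < 2*h*(h+1)^4 + h*(16*h+7)*(h+1)^3 * t
      + 4*(3*h+14*h^2+14*h^3-1)*(h+1)^2 * t ^ 2
      + (h+1)*(3*h+98*h^2+190*h^3+112*h^4-4) * t ^ 3
      + (2*h+109*h^2+322*h^3+356*h^4+140*h^5-5) * t ^ 4
      + 2*(h+1)*(5*h+46*h^2+88*h^3+56*h^4-1) * t ^ 5
      + (h+1)*(13*h+64*h^2+104*h^3+56*h^4-1) * t ^ 6 := by
    linarith
  have n7 : 0 ≤ xi7 h * (h * t) ^ 7 := by unfold xi7; positivity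
  have n8 : 0 ≤ xi8 h * (h * t) ^ 8 := by unfold xi8; positivity
  have n9 : 0 ≤ xi9 h * (h * t) ^ 9 := by unfold xi9; positivity
  have hmul := mul_pos (pow_pos hpos 8) hsum
  unfold p xi0 xi1 xi2 xi3 xi4 xi5 xi6
  linarith

lemma p_neg_of_one_le {h k : ℝ} (hh : 0 < h) (hh' : h < 4 / 25) (hk : 1 ≤ k) : p h k < 0 := by
  have b2 : -(1 / 10) ≤ xi2 h := by
    have : xi2 h = 4*h^6*(3*h+14*h^2+14*h^3)*(h+1)^2 - 4 * h ^ 6 * (h+1)^2 := by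
      unfold xi2; ring
    have h1 : 0 ≤ 4*h^6*(3*h+14*h^2+14*h^3)*(h+1)^2 := by positivity
    have h3 : 4 * h ^ 6 * (h+1)^2 ≤ 4 * (4/25) ^ 6 * (4/25+1)^2 := by gcongr
    norm_num at h3
    linarith
  have b3 : -(1 / 10) ≤ xi3 h := by
    have : xi3 h = h^5*(h+1)*(3*h+98*h^2+190*h^3+112*h^4) - 4 * h ^ 5 * (h+1) := by
      unfold xi3; ring
    have h1 : 0 ≤ h^5*(h+1)*(3*h+98*h^2+190*h^3+112*h^4) := by positivity
    have h3 : 4 * h ^ 5 * (h+1) ≤ 4 * (4/25) ^ 5 * (4/25+1) := by gcongr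
    norm_num at h3
    linarith
  have b4 : -(1 / 10) ≤ xi4 h := by
    have : xi4 h = h^4*(2*h+109*h^2+322*h^3+356*h^4+140*h^5) - 5 * h ^ 4 := by
      unfold xi4; ring
    have h1 : 0 ≤ h^4*(2*h+109*h^2+322*h^3+356*h^4+140*h^5) := by positivity
    have h3 : 5 * h ^ 4 ≤ 5 * (4/25) ^ 4 := by gcongr
    norm_num at h3
    linarith
  have b5 : -(1 / 10) ≤ xi5 h := by
    have : xi5 h = 2*h^3*(h+1)*(5*h+46*h^2+88*h^3+56*h^4) - 2 * h ^ 3 * (h+1) := by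
      unfold xi5; ring
    have h1 : 0 ≤ 2*h^3*(h+1)*(5*h+46*h^2+88*h^3+56*h^4) := by positivity
    have h3 : 2 * h ^ 3 * (h+1) ≤ 2 * (4/25) ^ 3 * (4/25+1) := by gcongr
    norm_num at h3
    linarith
  have b6 : -(1 / 10) ≤ xi6 h := by
    have : xi6 h = h^2*(h+1)*(13*h+64*h^2+104*h^3+56*h^4) - h ^ 2 * (h+1) := by
      unfold xi6; ring
    have h1 : 0 ≤ h^2*(h+1)*(13*h+64*h^2+104*h^3+56*h^4) := by positivity
    have h3 : h ^ 2 * (h+1) ≤ (4/25) ^ 2 * (4/25+1) := by gcongr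
    norm_num at h3
    linarith
  have b9 : 1 ≤ xi9 h := one_le_pow₀ (by linarith)
  have hk0 : 0 < k := by linarith
  have n0 : 0 ≤ xi0 h := by unfold xi0; positivity
  have n1 : 0 ≤ xi1 h * k := by unfold xi1; positivity
  have n7 : 0 ≤ xi7 h * k ^ 7 := by unfold xi7; positivity
  have n8 : 0 ≤ xi8 h * k ^ 8 := by unfold xi8; positivity
  have n9 : k ^ 9 ≤ xi9 h * k ^ 9 := le_mul_of_one_le_left (by positivity) b9
  have hlow : ∀ i ≤ 9, ∀ x : ℝ, -(1 / 10) ≤ x → -(1 / 10) * k ^ 9 ≤ x * k ^ i :=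
    fun i hi x hx => by
      have h1 : k ^ i ≤ k ^ 9 := pow_le_pow_right₀ hk hi
      have h2 : -(1 / 10) * k ^ i ≤ x * k ^ i := by gcongr
      linarith
  have e2 := hlow 2 (by norm_num) _ b2
  have e3 := hlow 3 (by norm_num) _ b3
  have e4 := hlow 4 (by norm_num) _ b4
  have e5 := hlow 5 (by norm_num) _ b5
  have e6 := hlow 6 (by norm_num) _ b6
  have : 0 < k ^ 9 := by positivity
  unfold p
  linarith

/-- For small `h` the coefficients `ξ_3(h), …, ξ_9(h)` change sign exactly once. -/
lemma exists_sign_change_xiSeq {h : ℝ} (hh : 0 < h) (hh' : h < 4 / 25) :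
    ∃ m, 2 < m ∧ (∀ i < 10, 2 < i → i < m → xiSeq h i ≤ 0) ∧
      (∀ i < 10, m ≤ i → 0 ≤ xiSeq h i) := by
  have s3 : xi3 h ≤ 0 := by
    refine mul_nonpos_of_nonneg_of_nonpos (by positivity) ?_
    have : 3*h+98*h^2+190*h^3+112*h^4
      ≤ 3*(4/25)+98*(4/25)^2+190*(4/25)^3+112*(4/25)^4 := by gcongr
    norm_num at this
    linarith
  have s4 : xi4 h ≤ 0 := by
    refine mul_nonpos_of_nonneg_of_nonpos (by positivity) ?_
    have : 2*h+109*h^2+322*h^3+356*h^4+140*h^5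
      ≤ 2*(4/25)+109*(4/25)^2+322*(4/25)^3+356*(4/25)^4+140*(4/25)^5 := by gcongr
    norm_num at this
    linarith
  have s7 : 0 ≤ xi7 h := by unfold xi7; positivity
  have s8 : 0 ≤ xi8 h := by unfold xi8; positivity
  have s9 : 0 ≤ xi9 h := by unfold xi9; positivity
  have s5 : 0 ≤ 5*h+46*h^2+88*h^3+56*h^4-1 → 0 ≤ xi5 h := fun H =>
    mul_nonneg (by positivity) H
  have s5' : 5*h+46*h^2+88*h^3+56*h^4-1 ≤ 0 → xi5 h ≤ 0 := fun H =>
    mul_nonpos_of_nonneg_of_nonpos (by positivity) H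
  have s6 : 0 ≤ 13*h+64*h^2+104*h^3+56*h^4-1 → 0 ≤ xi6 h := fun H =>
    mul_nonneg (by positivity) H
  have s6' : 13*h+64*h^2+104*h^3+56*h^4-1 ≤ 0 → xi6 h ≤ 0 := fun H =>
    mul_nonpos_of_nonneg_of_nonpos (by positivity) H
  have h56 : 5*h+46*h^2+88*h^3+56*h^4-1 ≤ 13*h+64*h^2+104*h^3+56*h^4-1 := by
    gcongr <;> norm_num
  rcases le_total 0 (5*h+46*h^2+88*h^3+56*h^4-1) with H5 | H5
  · have t5 := s5 H5
    have t6 := s6 (H5.trans h56)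
    refine ⟨5, by norm_num, fun i hi h2 hm => ?_, fun i hi hm => ?_⟩ <;>
      interval_cases i <;> assumption
  have t5 := s5' H5
  rcases le_total 0 (13*h+64*h^2+104*h^3+56*h^4-1) with H6 | H6
  · have t6 := s6 H6
    refine ⟨6, by norm_num, fun i hi h2 hm => ?_, fun i hi hm => ?_⟩ <;>
      interval_cases i <;> assumption
  · have t6 := s6' H6
    refine ⟨7, by norm_num, fun i hi h2 hm => ?_, fun i hi hm => ?_⟩ <;>
      interval_cases i <;> assumption

lemma p_ne_zero_of_two_smaller_roots {h : ℝ} (hh : 0 < h) (hh' : h < 4 / 25) {u v w : ℝ}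
    (hu : 0 < u) (huv : u < v) (hvw : v < w) (hpu : p h u = 0) (hpv : p h v = 0) :
    p h w ≠ 0 := by
  obtain ⟨m, hm, hlow, hhigh⟩ := exists_sign_change_xiSeq hh hh'
  rw [p_eq_neg_sum_xiSeq, neg_eq_zero] at hpu hpv
  rw [p_eq_neg_sum_xiSeq, neg_ne_zero]
  refine no_three_pos_roots (by norm_num) hm (xiSeq h) ?_ ?_ hlow hhigh hu huv hvw hpu hpv
  · change 0 < xi0 h
    unfold xi0
    positivity
  · change 0 ≤ xi1 h
    unfold xi1
    positivity

theorem vertical_line_meets_boundary_twice (a : ℝ) (ha : 0 < a)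
    (hint : ∃ k : ℝ, 0 < k ∧ 0 < p a k) :
    {k : ℝ | 0 < k ∧ p a k = 0}.encard = 2 := by
  obtain ⟨k, hk, hpk⟩ := hint
  have ha' : a < 4 / 25 := by
    by_contra! H
    exact (p_neg_of_ge H hk).not_gt hpk
  have hk1 : k < 1 := by
    by_contra! H
    exact (p_neg_of_one_le ha ha' H).not_gt hpk
  obtain ⟨x, hx, hpx⟩ := intermediate_value_Ioo hk.le (continuous_p_s13 a).continuousOn
    (show (0 : ℝ) ∈ Set.Ioo (p a 0) (p a k) from ⟨p_zero_neg ha, hpk⟩)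
  obtain ⟨y, hy, hpy⟩ := intermediate_value_Ioo' hk1.le (continuous_p_s13 a).continuousOn
    (show (0 : ℝ) ∈ Set.Ioo (p a 1) (p a k) from ⟨p_neg_of_one_le ha ha' le_rfl, hpk⟩)
  have hxy : x < y := hx.2.trans hy.1
  refine Set.encard_eq_two.2 ⟨x, y, hxy.ne, Set.ext fun z => ⟨?_, ?_⟩⟩
  · rintro ⟨hz, hpz⟩
    by_contra hne
    simp only [Set.mem_insert_iff, Set.mem_singleton_iff, not_or] at hne
    rcases lt_or_gt_of_ne hne.1 with hzx | hxz
    · exact p_ne_zero_of_two_smaller_roots ha ha' hz hzx hxy hpz hpx hpy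
    rcases lt_or_gt_of_ne hne.2 with hzy | hyz
    · exact p_ne_zero_of_two_smaller_roots ha ha' hx.1 hxz hzy hpx hpz hpy
    · exact p_ne_zero_of_two_smaller_roots ha ha' hx.1 hxy hyz hpx hpy hpz
  · rintro (rfl | rfl)
    · exact ⟨hx.1, hpx⟩
    · exact ⟨hx.1.trans hxy, hpy⟩
end
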